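/- Let p be a prime, let F₁ and F₂ be non-abelian free groups, and let G ≤ F₁ × F₂ be a subdirect product of finite index. Then the following are equivalent: (1) G is p-conjugacy separable; (2) F₁/N₁ is a finite p-group, where N₁ := G ∩ F₁; (3) the index |(F₁ × F₂) : G| is a power of p. -/

import Mathlib

/-- A bundled group (in universe 0). -/
structure GrpB where
  carrier : Type
  str : Group carrier

attribute [instance] GrpB.str

/-- Bundle a group type. -/
def GrpB.of (G : Type) [h : Group G] : GrpB := ⟨G, h⟩

/-- `C` is a pseudovariety of groups: closed under isomorphism, subgroups,
binary direct products and quotients. -/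
def IsPseudovariety (C : GrpB → Prop) : Prop :=
  (∀ A B : GrpB, C A → Nonempty (B.carrier ≃* A.carrier) → C B) ∧
  (∀ (A : GrpB) (H : Subgroup A.carrier), C A → C (GrpB.of H)) ∧
  (∀ A B : GrpB, C A → C B → C (GrpB.of (A.carrier × B.carrier))) ∧
  (∀ (A : GrpB) (N : Subgroup A.carrier) [N.Normal], C A → C (GrpB.of (A.carrier ⧸ N)))

/-- `C` is extension-closed. -/
def IsExtensionClosed (C : GrpB → Prop) : Prop :=
  ∀ (A : GrpB) (N : Subgroup A.carrier) [N.Normal],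
    C (GrpB.of N) → C (GrpB.of (A.carrier ⧸ N)) → C A

/-- Every member of `C` is a finite group. -/
def ClassOfFiniteGroups (C : GrpB → Prop) : Prop := ∀ A : GrpB, C A → Finite A.carrier

/-- `C` contains at least one non-trivial group. -/
def ClassNontrivial (C : GrpB → Prop) : Prop := ∃ A : GrpB, C A ∧ ∃ a : A.carrier, a ≠ 1

/-- `P` is residually-`C`. -/
def ResiduallyC (C : GrpB → Prop) (P : Type) [Group P] : Prop :=
  ∀ p : P, p ≠ 1 → ∃ M : GrpB, C M ∧ ∃ φ : P →* M.carrier, φ p ≠ 1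

/-- `G` is `C`-conjugacy separable. -/
def ConjSepC (C : GrpB → Prop) (G : Type) [Group G] : Prop :=
  ∀ x y : G, ¬ IsConj x y → ∃ M : GrpB, C M ∧ ∃ φ : G →* M.carrier, ¬ IsConj (φ x) (φ y)

/-- `N` is a co-`C` (normal) subgroup of `F`. -/
def IsCoC (C : GrpB → Prop) {F : Type} [Group F] (N : Subgroup F) : Prop :=
  ∃ hn : N.Normal, letI := hn; C (GrpB.of (F ⧸ N))

/-- The pro-`C` topology on `F`: generated by the cosets of co-`C` subgroups. -/
def ProCTop (C : GrpB → Prop) (F : Type) [Group F] : TopologicalSpace F :=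
  TopologicalSpace.generateFrom
    {S : Set F | ∃ N : Subgroup F, IsCoC C N ∧ ∃ g : F, S = {x : F | g⁻¹ * x ∈ N}}

/-- `X` is closed in the pro-`C` topology on `F`. -/
def CClosed (C : GrpB → Prop) {F : Type} [Group F] (X : Set F) : Prop :=
  @IsClosed F (ProCTop C F) X

/-- `X` is open in the pro-`C` topology on `F`. -/
def COpen (C : GrpB → Prop) {F : Type} [Group F] (X : Set F) : Prop :=
  @IsOpen F (ProCTop C F) X

/-- Closure of `X` in the pro-`C` topology on `F`. -/
def CClosure (C : GrpB → Prop) {F : Type} [Group F] (X : Set F) : Set F :=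
  @closure F (ProCTop C F) X

/-- `F` is `C`-hereditarily conjugacy separable: every `C`-open subgroup is
`C`-conjugacy separable. -/
def HerConjSepC (C : GrpB → Prop) (F : Type) [Group F] : Prop :=
  ∀ H : Subgroup F, COpen C (H : Set F) → ConjSepC C H

/-- `M` is cyclic subgroup `C`-separable: every cyclic subgroup is `C`-closed. -/
def CyclicSubgroupSepC (C : GrpB → Prop) (M : Type) [Group M] : Prop :=
  ∀ m : M, CClosed C ((Subgroup.zpowers m : Subgroup M) : Set M)

/-- `M` is highly residually-`C`: every extension of a `C`-group by `M` is residually-`C`. -/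
def HighlyResiduallyC (C : GrpB → Prop) (M : Type) [Group M] : Prop :=
  ∀ (L : Type) [Group L], ∀ (K : Subgroup L) [K.Normal],
    C (GrpB.of K) → Nonempty ((L ⧸ K) ≃* M) → ResiduallyC C L

/-- `F` has cyclic centralizers. -/
def HasCyclicCentralizers (F : Type) [Group F] : Prop :=
  ∀ f : F, f ≠ 1 → IsCyclic (Subgroup.centralizer ({f} : Set F))

/-- `G ≤ F₁ × F₂` is a subdirect product. -/
def IsSubdirect {F₁ F₂ : Type} [Group F₁] [Group F₂] (G : Subgroup (F₁ × F₂)) : Prop :=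
  Subgroup.map (MonoidHom.fst F₁ F₂) G = ⊤ ∧ Subgroup.map (MonoidHom.snd F₁ F₂) G = ⊤

/-- `G ≤ F₁ × F₂` is a full subdirect product. -/
def IsFullSubdirect {F₁ F₂ : Type} [Group F₁] [Group F₂] (G : Subgroup (F₁ × F₂)) : Prop :=
  IsSubdirect G ∧ Subgroup.comap (MonoidHom.inl F₁ F₂) G ≠ ⊥ ∧
    Subgroup.comap (MonoidHom.inr F₁ F₂) G ≠ ⊥

/-- `F` is a free group (of arbitrary rank). -/
def IsFreeGroupType (F : Type) [Group F] : Prop := ∃ S : Type, Nonempty (F ≃* FreeGroup S)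

/-- `F` is a non-abelian free group. -/
def IsNonAbelianFree (F : Type) [Group F] : Prop :=
  IsFreeGroupType F ∧ ∃ a b : F, a * b ≠ b * a

/-- The class of finite `p`-groups. -/
def CP (p : ℕ) : GrpB → Prop := fun A => Finite A.carrier ∧ IsPGroup p A.carrier

/-- The class of all finite groups. -/
def CFin : GrpB → Prop := fun A => Finite A.carrier

/-- A `Q'`-group: every element has finite order coprime to every `q ∈ Q`. -/
def IsQPrimeGroup (Q : Set ℕ) (F : Type) [Group F] : Prop :=
  ∀ f : F, IsOfFinOrder f ∧ ∀ q ∈ Q, Nat.Coprime (orderOf f) q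

/-- `x` and `y` have conjugate images in every finite `p`-group quotient. -/
def PConj (p : ℕ) {G : Type} [Group G] (x y : G) : Prop :=
  ∀ (M : Type) [Group M] [Finite M], IsPGroup p M → ∀ φ : G →* M, IsConj (φ x) (φ y)

lemma PConj.symm {p : ℕ} {G : Type} [Group G] {x y : G} (h : PConj p x y) : PConj p y x :=
  fun M _ _ hM φ => (h M hM φ).symm

lemma PConj.map {p : ℕ} {G H : Type} [Group G] [Group H] {x y : G} (h : PConj p x y)
    (f : G →* H) : PConj p (f x) (f y) :=
  fun M _ _ hM φ => h M hM (φ.comp f)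

lemma PConj.eq_of_comm {p : ℕ} {G M : Type} [Group G] [CommGroup M] [Finite M] {x y : G}
    (h : PConj p x y) (hM : IsPGroup p M) (φ : G →* M) : φ x = φ y :=
  isConj_iff_eq.mp (h M hM φ)

namespace RegularWreathProduct

/-- Functoriality of the regular wreath product in the base group. -/
def mapBase {D P : Type*} [Group D] [Group P] (f : D →* P) (C : Type*) [Group C] :
    D ≀ᵣ C →* P ≀ᵣ C where
  toFun w := ⟨fun i => f (w.left i), w.right⟩
  map_one' := by ext <;> simp
  map_mul' a b := by ext <;> simp

lemma isPGroup {p : ℕ} [Fact p.Prime] {P C : Type*} [Group P] [Group C] [Finite P] [Finite C]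
    (hP : IsPGroup p P) (hC : IsPGroup p C) : IsPGroup p (P ≀ᵣ C) := by
  obtain ⟨m, hm⟩ := IsPGroup.iff_card.mp hP
  obtain ⟨n, hn⟩ := IsPGroup.iff_card.mp hC
  refine IsPGroup.of_card (n := m * p ^ n + n) ?_
  rw [RegularWreathProduct.card, hm, hn, ← pow_mul, ← pow_add]

end RegularWreathProduct

open RegularWreathProduct in
lemma PConj.exists_left {p : ℕ} [Fact p.Prime] {G D C : Type} [Group G] [Group D] [Group C]
    [Finite C] (hC : IsPGroup p C) {u v : G} (h : PConj p u v) (Φ : G →* D ≀ᵣ C)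
    (hv : (Φ v).right = 1) :
    ∃ r, PConj p ((Φ u).left 1) ((Φ v).left r) := by
  by_contra! hcon
  simp only [PConj] at hcon
  push Not at hcon
  choose M hG hfin hM f hf using hcon
  have hprod : IsPGroup p (∀ r, M r) := by
    have := fun r => IsPGroup.iff_card.mp (hM r)
    choose n hn using this
    have := Fintype.ofFinite C
    refine IsPGroup.of_card (n := ∑ r, n r) ?_
    rw [Nat.card_pi, Finset.prod_congr rfl fun r _ => hn r, Finset.prod_pow_eq_pow_sum]
  obtain ⟨w, hw⟩ := isConj_iff.mp
    (h _ (RegularWreathProduct.isPGroup hprod hC) ((mapBase (MonoidHom.pi f) C).comp Φ))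
  apply hf w.right
  rw [mul_inv_eq_iff_eq_mul] at hw
  have := congrFun (congrFun (congrArg left hw) w.right) w.right
  simp [mapBase, hv] at this
  exact isConj_iff.mpr ⟨w.left w.right w.right, by rw [mul_inv_eq_iff_eq_mul]; exact this⟩

namespace FreeGroup

lemma mk_cons_eq {S : Type*} (x : S) (b : Bool) (L : List (S × Bool)) :
    mk ((x, b) :: L) = (bif b then of x else (of x)⁻¹) * mk L := by
  cases b <;> rfl

lemma exists_mk_eq_zpow {S : Type*} (x : S) (L : List (S × Bool)) (h : ∀ y ∈ L, y.1 = x) :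
    ∃ k : ℤ, mk L = of x ^ k := by
  induction L with
  | nil => exact ⟨0, by rw [zpow_zero]; rfl⟩
  | cons y L ih =>
    obtain ⟨k, hk⟩ := ih fun z hz => h z (List.mem_cons_of_mem _ hz)
    obtain ⟨y, b⟩ := y
    obtain rfl : y = x := h (y, b) List.mem_cons_self
    rw [mk_cons_eq, hk]
    cases b
    · exact ⟨-1 + k, by rw [zpow_add]; simp⟩
    · exact ⟨1 + k, by rw [zpow_add]; simp⟩

section Norm

variable {S T C : Type*} [DecidableEq T] [Group C] (Φ : FreeGroup S →* FreeGroup T ≀ᵣ C)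

lemma norm_wreath_mk_le (hΦ : ∀ s i, ((Φ (of s)).left i).norm ≤ 1) (L : List (S × Bool)) (i : C) :
    ((Φ (mk L)).left i).norm ≤ L.length := by
  induction L generalizing i with
  | nil => rw [show (mk [] : FreeGroup S) = 1 from rfl]; simp
  | cons y L ih =>
    obtain ⟨s, b⟩ := y
    rw [mk_cons_eq, _root_.map_mul, RegularWreathProduct.mul_left, List.length_cons, add_comm]
    refine (norm_mul_le _ _).trans (add_le_add ?_ (ih _))
    cases b
    · simpa using hΦ s _
    · exact hΦ s i

lemma exists_norm_wreath_mk_lt (hΦ : ∀ s i, ((Φ (of s)).left i).norm ≤ 1)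
    (L₁ L₂ : List (S × Bool)) (x : S) (b : Bool)
    (hx : (Φ (of x)).left ((bif b then 1 else (Φ (of x)).right) * (Φ (mk L₁)).right⁻¹) = 1) :
    ((Φ (mk (L₁ ++ (x, b) :: L₂))).left 1).norm < (L₁ ++ (x, b) :: L₂).length := by
  rw [← mul_mk, mk_cons_eq, _root_.map_mul, _root_.map_mul, RegularWreathProduct.mul_left,
    RegularWreathProduct.mul_left, List.length_append, List.length_cons]
  have hb : (Φ (bif b then of x else (of x)⁻¹)).left ((Φ (mk L₁)).right⁻¹) = 1 := by
    cases b
    · simpa using hx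
    · simpa using hx
  have h₁ := norm_wreath_mk_le Φ hΦ L₁ 1
  simp only [Pi.mul_apply, mul_one, hb, one_mul]
  refine (norm_mul_le _ _).trans_lt ?_
  have := norm_wreath_mk_le Φ hΦ L₂
    ((Φ (bif b then of x else (of x)⁻¹)).right⁻¹ * (Φ (mk L₁)).right⁻¹)
  lia

end Norm

/-- The homomorphism `FreeGroup S → FreeGroup (S × ℤ/p) ≀ ℤ/p` recording lifts of words to the
`p`-fold cover of the rose given by `χ`, where all edges labelled `x` except the one at `c`
are collapsed. -/
noncomputable def coverHom {p : ℕ} {S : Type} (χ : S → ZMod p) (x : S)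
    (c : Multiplicative (ZMod p)) :
    FreeGroup S →* FreeGroup (S × Multiplicative (ZMod p)) ≀ᵣ Multiplicative (ZMod p) :=
  open Classical in
  lift fun s => ⟨fun i => if s = x ∧ i ≠ c then 1 else of (s, i), Multiplicative.ofAdd (χ s)⟩

lemma right_coverHom {p : ℕ} {S : Type} (χ : S → ZMod p) (x : S) (c : Multiplicative (ZMod p))
    (w : FreeGroup S) :
    (coverHom χ x c w).right = lift (fun s => Multiplicative.ofAdd (χ s)) w := by
  suffices h : RegularWreathProduct.rightHom.comp (coverHom χ x c) =
      lift (fun s => Multiplicative.ofAdd (χ s)) from DFunLike.congr_fun h w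
  ext s
  simp [coverHom]

lemma exists_lift_left_coverHom {p : ℕ} [Fact p.Prime] {S : Type} (χ : S → ZMod p) (x : S)
    (hx : χ x = 1) (c : Multiplicative (ZMod p)) :
    ∃ (ψ : FreeGroup (S × Multiplicative (ZMod p)) →* FreeGroup S)
      (τ : Multiplicative (ZMod p) → FreeGroup S), ∀ w i,
        ψ ((coverHom χ x c w).left i) = τ i * w * (τ ((coverHom χ x c w).right⁻¹ * i))⁻¹ := by
  let τ : Multiplicative (ZMod p) → FreeGroup S :=
    fun i => (of x)⁻¹ ^ (Multiplicative.toAdd i - Multiplicative.toAdd c).val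
  let ψ : FreeGroup (S × Multiplicative (ZMod p)) →* FreeGroup S :=
    lift fun y => τ y.2 * of y.1 * (τ (Multiplicative.ofAdd (-χ y.1) * y.2))⁻¹
  have hτ : ∀ i, i ≠ c → τ i * of x * (τ (Multiplicative.ofAdd (-χ x) * i))⁻¹ = 1 := by
    intro i hi
    have hi' : Multiplicative.toAdd i - Multiplicative.toAdd c ≠ 0 := sub_ne_zero.mpr hi
    generalize hj : Multiplicative.toAdd i - Multiplicative.toAdd c = j at hi'
    have h1 : Multiplicative.toAdd (Multiplicative.ofAdd (-χ x) * i) - Multiplicative.toAdd c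
        = j - 1 := by
      rw [toAdd_mul, toAdd_ofAdd, hx, ← hj]; ring
    have h2 : j.val = (j - 1).val + 1 := by
      have hlt : 1 < p := (Fact.out : p.Prime).one_lt
      have h0 : j.val ≠ 0 := by simpa using hi'
      have := Fact.mk hlt
      rw [ZMod.val_sub (by rw [ZMod.val_one]; lia), ZMod.val_one]
      lia
    simp only [τ]
    rw [h1, hj, h2, pow_succ]
    group
  refine ⟨ψ, τ, fun w => ?_⟩
  induction w using FreeGroup.induction_on with
  | C1 => simp
  | of s =>
    intro i
    by_cases h : s = x ∧ i ≠ c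
    · obtain ⟨rfl, hi⟩ := h
      simpa [coverHom, hi, ofAdd_neg] using (hτ i hi).symm
    · simp [coverHom, h, ψ, ofAdd_neg]
  | inv_of s ih =>
    intro i
    rw [_root_.map_inv, RegularWreathProduct.inv_left]
    simp [ih, mul_assoc]
  | mul v w hv hw =>
    intro i
    simp only [_root_.map_mul, RegularWreathProduct.mul_left, Pi.mul_apply, hv, hw,
      RegularWreathProduct.mul_right]
    simp [mul_assoc]

/-- The induction step: passing to a `p`-fold cover shortens the word `u`. -/
lemma exists_shorter_of_pConj {p : ℕ} [Fact p.Prime] {S : Type} [DecidableEq S] {u v : FreeGroup S}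
    (h : PConj p u v) (χ : S → ZMod p)
    (hu : lift (fun s => Multiplicative.ofAdd (χ s)) u = 1)
    {x : S} {b : Bool} (hmem : (x, b) ∈ u.toWord) (hx : χ x = 1) :
    ∃ (T : Type) (_ : DecidableEq T) (u' v' : FreeGroup T), u'.norm < u.norm ∧ v'.norm ≤ v.norm ∧
      PConj p u' v' ∧ (IsConj u' v' → IsConj u v) := by
  have hC : IsPGroup p (Multiplicative (ZMod p)) :=
    IsPGroup.of_card (n := 1) (by simp)
  obtain ⟨L₁, L₂, hL⟩ := List.append_of_mem hmem
  let j := (bif b then 1 else Multiplicative.ofAdd (χ x)) *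
    (lift (fun s => Multiplicative.ofAdd (χ s)) (mk L₁))⁻¹
  obtain ⟨c, hc⟩ := exists_ne j
  have hΦ : ∀ s i, ((coverHom χ x c (of s)).left i).norm ≤ 1 := by
    intro s i
    simp only [coverHom, lift_apply_of]
    split_ifs <;> simp
  have hv : lift (fun s => Multiplicative.ofAdd (χ s)) v = 1 := by
    rw [← hu, h.eq_of_comm hC]
  obtain ⟨r, hr⟩ := h.exists_left hC (coverHom χ x c) (by rw [right_coverHom, hv])
  refine ⟨_, inferInstance, _, _, ?_, ?_, hr, fun hconj => ?_⟩
  · have := exists_norm_wreath_mk_lt (coverHom χ x c) hΦ L₁ L₂ x b (by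
      rw [right_coverHom, right_coverHom, lift_apply_of]
      change (coverHom χ x c (of x)).left j = 1
      simp [coverHom, hc.symm])
    rwa [← hL, mk_toWord] at this
  · have := norm_wreath_mk_le (coverHom χ x c) hΦ v.toWord r
    rwa [mk_toWord] at this
  · obtain ⟨ψ, τ, hψ⟩ := exists_lift_left_coverHom χ x hx c
    have := ψ.map_isConj hconj
    rw [hψ, hψ, right_coverHom, right_coverHom, hu, hv, inv_one, one_mul, one_mul] at this
    exact (isConj_iff.mpr ⟨_, rfl⟩).trans (this.trans (isConj_iff.mpr ⟨_, rfl⟩).symm)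

lemma eq_of_pConj_zpow {p : ℕ} [Fact p.Prime] {S : Type} (x : S) {k l : ℤ}
    (h : PConj p (of x ^ k) (of x ^ l)) : k = l := by
  have hlt : (k - l).natAbs < p ^ (k - l).natAbs :=
    Nat.lt_pow_self (Fact.out : p.Prime).one_lt
  set n := (k - l).natAbs with hn
  have hC : IsPGroup p (Multiplicative (ZMod (p ^ n))) :=
    IsPGroup.of_card (n := n) (by simp)
  have : NeZero (p ^ n) := ⟨pow_ne_zero _ (Fact.out : p.Prime).ne_zero⟩
  have := h.eq_of_comm hC (lift fun _ => Multiplicative.ofAdd 1)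
  rw [_root_.map_zpow, _root_.map_zpow, lift_apply_of, ← ofAdd_zsmul, ← ofAdd_zsmul] at this
  have := Multiplicative.ofAdd.injective this
  simp only [zsmul_one] at this
  rw [← sub_eq_zero, ← Int.cast_sub, ZMod.intCast_zmod_eq_zero_iff_dvd] at this
  have := Int.eq_zero_of_dvd_of_natAbs_lt_natAbs this (by rwa [Int.natAbs_natCast])
  lia

/-- Either all letters of `u` and `v` agree, or a character kills `u` but not some letter. -/
lemma exists_char_or_single {p : ℕ} [Fact p.Prime] {S : Type} [DecidableEq S] (u v : FreeGroup S) :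
    (∃ χ : S → ZMod p, lift (fun s => Multiplicative.ofAdd (χ s)) u = 1 ∧
      ∃ y ∈ u.toWord ++ v.toWord, χ y.1 = 1) ∨
    ∀ y ∈ u.toWord ++ v.toWord, ∀ z ∈ u.toWord ++ v.toWord, y.1 = z.1 := by
  by_contra! ⟨hχ, y, hy, z, hz, hyz⟩
  let e (s : S) : FreeGroup S →* Multiplicative (ZMod p) :=
    lift fun t => Multiplicative.ofAdd (if t = s then 1 else 0)
  have hcomb (α β : ZMod p) :
      lift (fun t => Multiplicative.ofAdd (α * (if t = y.1 then 1 else 0) +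
        β * (if t = z.1 then 1 else 0))) u =
      Multiplicative.ofAdd (α * Multiplicative.toAdd (e y.1 u) +
        β * Multiplicative.toAdd (e z.1 u)) := by
    generalize u = u
    induction u using FreeGroup.induction_on with
    | C1 => simp
    | of s => simp [e]
    | inv_of s ih =>
      rw [_root_.map_inv, ih, _root_.map_inv (e y.1), _root_.map_inv (e z.1), toAdd_inv, toAdd_inv,
        ← ofAdd_neg]
      congr 1
      ring
    | mul a b ha hb =>
      rw [_root_.map_mul, ha, hb, _root_.map_mul (e y.1), _root_.map_mul (e z.1), toAdd_mul,
        toAdd_mul, ← ofAdd_add]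
      congr 1
      ring
  by_cases hzu : Multiplicative.toAdd (e z.1 u) = 0
  · refine hχ (fun t => 0 * (if t = y.1 then 1 else 0) + 1 * (if t = z.1 then 1 else 0))
      ?_ z hz (by simp)
    rw [hcomb, hzu]; simp
  · refine hχ (fun t => 1 * (if t = y.1 then 1 else 0) +
      (-(Multiplicative.toAdd (e y.1 u)) / Multiplicative.toAdd (e z.1 u)) *
        (if t = z.1 then 1 else 0)) ?_ y hy (by simp [hyz])
    rw [hcomb, div_mul_cancel₀ _ hzu]; simp

lemma isConj_of_pConj_of_decidableEq {p : ℕ} [Fact p.Prime] {S : Type} [DecidableEq S]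
    {u v : FreeGroup S} (h : PConj p u v) : IsConj u v := by
  induction hn : u.norm + v.norm using Nat.strong_induction_on generalizing S with
  | _ n ih =>
  subst hn
  rcases exists_char_or_single (p := p) u v with ⟨χ, hχ, ⟨x, b⟩, hmem, hx⟩ | hall
  · rcases List.mem_append.mp hmem with hmem | hmem
    · obtain ⟨T, _, u', v', hu', hv', h', hback⟩ := exists_shorter_of_pConj h χ hχ hmem hx
      exact hback (ih _ (by lia) h' rfl)
    · have hv : lift (fun s => Multiplicative.ofAdd (χ s)) v = 1 := by
        rw [← hχ, h.eq_of_comm (IsPGroup.of_card (n := 1) (by simp))]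
      obtain ⟨T, _, u', v', hu', hv', h', hback⟩ := exists_shorter_of_pConj h.symm χ hv hmem hx
      exact (hback (ih _ (by lia) h' rfl)).symm
  · by_cases hnil : u.toWord ++ v.toWord = []
    · obtain ⟨hu, hv⟩ := List.append_eq_nil_iff.mp hnil
      rw [toWord_eq_nil_iff] at hu hv
      rw [hu, hv]
    · obtain ⟨y, hy⟩ := List.exists_mem_of_ne_nil _ hnil
      obtain ⟨k, hk⟩ := exists_mk_eq_zpow y.1 u.toWord
        fun z hz => hall z (List.mem_append_left _ hz) y hy
      obtain ⟨l, hl⟩ := exists_mk_eq_zpow y.1 v.toWord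
        fun z hz => hall z (List.mem_append_right _ hz) y hy
      rw [mk_toWord] at hk hl
      rw [hk, hl] at h ⊢
      rw [eq_of_pConj_zpow y.1 h]

/-- Free groups are conjugacy `p`-separable. -/
theorem isConj_of_pConj {p : ℕ} [Fact p.Prime] {S : Type} {u v : FreeGroup S}
    (h : PConj p u v) : IsConj u v := by
  classical exact isConj_of_pConj_of_decidableEq h

end FreeGroup

lemma Subgroup.finiteIndex_comap {F H : Type*} [Group F] [Group H] (L : Subgroup F)
    [L.FiniteIndex] (f : H →* F) : (L.comap f).FiniteIndex :=
  ⟨by rw [Subgroup.index_comap]; exact (L.subgroupOf f.range).index_ne_zero_of_finite⟩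

/-- `L` is a normal subgroup whose quotient is a finite `p`-group. -/
structure IsCoP (p : ℕ) {F : Type} [Group F] (L : Subgroup F) : Prop where
  normal : L.Normal
  finiteIndex : L.FiniteIndex
  exists_pow_mem : ∀ g, ∃ k, g ^ p ^ k ∈ L

namespace IsCoP

variable {p : ℕ} {F H : Type} [Group F] [Group H]

lemma pow_mem_of_le {L : Subgroup F} {g : F} {k l : ℕ} (hg : g ^ p ^ k ∈ L) (hkl : k ≤ l) :
    g ^ p ^ l ∈ L := by
  obtain ⟨m, rfl⟩ := Nat.exists_eq_add_of_le hkl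
  rw [pow_add, pow_mul]
  exact L.pow_mem hg _

lemma iInf {ι : Type} [Finite ι] {L : ι → Subgroup F} (hL : ∀ i, IsCoP p (L i)) :
    IsCoP p (⨅ i, L i) where
  normal := Subgroup.normal_iInf_normal fun i => (hL i).normal
  finiteIndex := Subgroup.finiteIndex_iInf fun i => (hL i).finiteIndex
  exists_pow_mem g := by
    choose k hk using fun i => (hL i).exists_pow_mem g
    have := Fintype.ofFinite ι
    exact ⟨Finset.univ.sup k, Subgroup.mem_iInf.mpr fun i =>
      pow_mem_of_le (hk i) (Finset.le_sup (Finset.mem_univ i))⟩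

lemma comap {L : Subgroup F} (hL : IsCoP p L) (f : H →* F) : IsCoP p (L.comap f) where
  normal := have := hL.normal; inferInstance
  finiteIndex := have := hL.finiteIndex; L.finiteIndex_comap f
  exists_pow_mem g := by simpa using hL.exists_pow_mem (f g)

lemma ker [Finite H] (hH : IsPGroup p H) (f : F →* H) : IsCoP p f.ker where
  normal := inferInstance
  finiteIndex := inferInstance
  exists_pow_mem g := by simpa [MonoidHom.mem_ker] using hH (f g)

lemma finite_quotient {L : Subgroup F} (hL : IsCoP p L) : Finite (F ⧸ L) :=
  have := hL.finiteIndex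
  inferInstance

lemma isPGroup_quotient {L : Subgroup F} [L.Normal] (hL : IsCoP p L) : IsPGroup p (F ⧸ L) := by
  intro g
  induction g using QuotientGroup.induction_on with
  | H g =>
    obtain ⟨k, hk⟩ := hL.exists_pow_mem g
    exact ⟨k, by rwa [← QuotientGroup.mk_pow, QuotientGroup.eq_one_iff]⟩

lemma normalCore {N K : Subgroup F} (hN : IsCoP p N) (hNK : N ≤ K) {L : Subgroup K}
    (hL : IsCoP p L) : IsCoP p (L.map K.subtype ⊓ N).normalCore where
  normal := inferInstance
  finiteIndex := by
    have := hN.finiteIndex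
    have := hL.finiteIndex
    have : K.FiniteIndex := Subgroup.finiteIndex_of_le hNK
    have : (L.map K.subtype).FiniteIndex := ⟨by
      rw [Subgroup.index_map_subtype]
      exact mul_ne_zero L.index_ne_zero_of_finite K.index_ne_zero_of_finite⟩
    infer_instance
  exists_pow_mem g := by
    obtain ⟨k, hk⟩ := hN.exists_pow_mem g
    have hconj (b : F) : b * g ^ p ^ k * b⁻¹ ∈ N := hN.normal.conj_mem _ hk b
    have hpow : ∃ l, ∀ b : F, (b * g ^ p ^ k * b⁻¹) ^ p ^ l ∈ L.map K.subtype := by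
      have := hL.normal
      have := hL.finite_quotient
      obtain ⟨l, hl⟩ := isPGroup_iff_exists_pow_pow_eq_one.mp hL.isPGroup_quotient
      refine ⟨l, fun b => ⟨⟨_, hNK (hconj b)⟩ ^ p ^ l, ?_, rfl⟩⟩
      have := hl (QuotientGroup.mk ⟨_, hNK (hconj b)⟩)
      rwa [← QuotientGroup.mk_pow, QuotientGroup.eq_one_iff] at this
    obtain ⟨l, hl⟩ := hpow
    refine ⟨k + l, fun b => ?_⟩
    rw [pow_add, pow_mul, ← conj_pow]
    exact ⟨hl b, N.pow_mem (hconj b) _⟩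

end IsCoP

/-- Orbits of co-`p` subgroups acting by conjugation on a free group are closed in the
pro-`p` topology. -/
lemma exists_isCoP_separating {p : ℕ} [Fact p.Prime] {F : Type} [Group F] [IsFreeGroup F]
    {N : Subgroup F} (hN : IsCoP p N) (u v : F) (huv : ∀ n ∈ N, n * u * n⁻¹ ≠ v) :
    ∃ L : Subgroup F, IsCoP p L ∧ ∀ n ∈ N, n * u * n⁻¹ * v⁻¹ ∉ L := by
  have := hN.normal
  by_cases hmem : u * v⁻¹ ∈ N
  · let K := N ⊔ Subgroup.zpowers u
    have hNK : N ≤ K := le_sup_left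
    have huK : u ∈ K := (le_sup_right : _ ≤ K) (Subgroup.mem_zpowers u)
    have hvK : v ∈ K := by
      have := K.mul_mem (K.inv_mem (hNK hmem)) huK
      simpa using this
    have hK : ¬ IsConj (⟨u, huK⟩ : K) ⟨v, hvK⟩ := by
      rintro hconj
      obtain ⟨⟨c, hc⟩, h⟩ := isConj_iff.mp hconj
      obtain ⟨n, hn, z, ⟨k, rfl⟩, rfl⟩ := Subgroup.mem_sup_of_normal_left.mp hc
      refine huv n hn ?_
      have := congrArg Subtype.val h
      simp only [Subgroup.coe_mul, Subgroup.coe_inv, mul_inv_rev] at this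
      rw [← this]
      group
    have hsep : ¬ PConj p (⟨u, huK⟩ : K) ⟨v, hvK⟩ := fun h => hK <| by
      have := (IsFreeGroup.mulEquiv K).toMonoidHom.map_isConj
        (FreeGroup.isConj_of_pConj (h.map (IsFreeGroup.mulEquiv K).symm.toMonoidHom))
      simpa using this
    simp only [PConj] at hsep
    push Not at hsep
    obtain ⟨M, _, _, hM, φ, hφ⟩ := hsep
    refine ⟨_, hN.normalCore hNK (IsCoP.ker hM φ), fun n hn hL => hφ ?_⟩
    obtain ⟨⟨⟨w, hw⟩, hwφ, hwn⟩, -⟩ := Subgroup.normalCore_le _ hL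
    have hwn : (⟨w, hw⟩ : K) = ⟨n, hNK hn⟩ * ⟨u, huK⟩ * ⟨n, hNK hn⟩⁻¹ * ⟨v, hvK⟩⁻¹ :=
      Subtype.ext hwn
    rw [hwn, SetLike.mem_coe, MonoidHom.mem_ker, map_mul, map_mul, map_mul, map_inv, map_inv,
      mul_inv_eq_one] at hwφ
    exact isConj_iff.mpr ⟨_, hwφ⟩
  · refine ⟨N, hN, fun n hn h => hmem ?_⟩
    rw [← QuotientGroup.eq_one_iff] at h hn ⊢
    simpa [hn] using h

lemma RegularWreathProduct.left_commutator_conj_inl {D C : Type*} [CommGroup D] [Group C]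
    (f : C → D) (A q : C) :
    ((⟨f, 1⟩ * inl A * (⟨f, 1⟩)⁻¹) * inl A * (⟨f, 1⟩ * inl A * (⟨f, 1⟩)⁻¹)⁻¹ * (inl A)⁻¹ :
      D ≀ᵣ C).left q = f q * f (A⁻¹ * q) ^ (-2 : ℤ) * f (A⁻¹ * (A⁻¹ * q)) := by
  simp [mul_assoc, zpow_ofNat, pow_two, mul_comm, mul_left_comm]

/-- In the wreath product of `ℤ` by `Q × ℤ`, the image of a suitable commutator
`[a ^ m, b ^ m]` has centralizer projecting trivially to `Q`. -/
lemma FreeGroup.exists_centralizer_le_ker {S Q : Type} [Group Q] (α : FreeGroup S →* Q) {m : ℕ}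
    (hm : m ≠ 0) (hQ : ∀ q : Q, q ^ m = 1) {a b : S} (hab : a ≠ b) :
    ∃ x, α x = 1 ∧ ∀ g, g * x = x * g → α g = 1 := by
  classical
  let f : Q × Multiplicative ℤ → Multiplicative ℤ :=
    fun q => if q = 1 then Multiplicative.ofAdd 1 else 1
  let t : Multiplicative ℤ ≀ᵣ (Q × Multiplicative ℤ) := ⟨f, 1⟩
  let β : S → Q × Multiplicative ℤ := fun s => (α (of s), Multiplicative.ofAdd 1)
  let A : Q × Multiplicative ℤ := (1, Multiplicative.ofAdd (m : ℤ))
  have hβ (s : S) : β s ^ m = A := by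
    simp [β, A, hQ, ← ofAdd_nsmul]
  let Φ : FreeGroup S →* Multiplicative ℤ ≀ᵣ (Q × Multiplicative ℤ) :=
    lift fun s => if s = a then t * RegularWreathProduct.inl (β s) * t⁻¹
      else RegularWreathProduct.inl (β s)
  have hΦ (g : FreeGroup S) : (Φ g).right.1 = α g := by
    suffices h : ((MonoidHom.fst _ _).comp RegularWreathProduct.rightHom).comp Φ = α from
      DFunLike.congr_fun h g
    ext s
    by_cases hs : s = a <;> simp [Φ, hs, β, t]
  let x := of a ^ m * of b ^ m * (of a ^ m)⁻¹ * (of b ^ m)⁻¹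
  have hx : Φ x = t * RegularWreathProduct.inl A * t⁻¹ * RegularWreathProduct.inl A *
      (t * RegularWreathProduct.inl A * t⁻¹)⁻¹ * (RegularWreathProduct.inl A)⁻¹ := by
    have ha : Φ (of a ^ m) = t * RegularWreathProduct.inl A * t⁻¹ := by
      rw [_root_.map_pow, lift_apply_of, if_pos rfl, conj_pow, ← _root_.map_pow, hβ]
    have hb : Φ (of b ^ m) = RegularWreathProduct.inl A := by
      rw [_root_.map_pow, lift_apply_of, if_neg hab.symm, ← _root_.map_pow, hβ]
    simp only [x, _root_.map_mul, _root_.map_inv, ha, hb]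
  have hright : (Φ x).right = 1 := by
    rw [hx]; simp [t]
  have hleft_one : (Φ x).left 1 ≠ 1 := by
    have h1 : A⁻¹ * 1 ≠ 1 := by
      simp [A, Prod.ext_iff, hm]
    have h2 : A⁻¹ * (A⁻¹ * 1) ≠ 1 := by
      simp [A, Prod.ext_iff, ← ofAdd_neg, ← ofAdd_add]
      lia
    rw [hx, RegularWreathProduct.left_commutator_conj_inl]
    simp only [f, if_neg h1, if_neg h2, if_true]
    decide
  have hleft (q : Q × Multiplicative ℤ) (hq : (Φ x).left q ≠ 1) : q.1 = 1 := by
    contrapose! hq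
    have h0 : q ≠ 1 := fun h => hq (congrArg Prod.fst h)
    have h1 : A⁻¹ * q ≠ 1 := fun h => hq (by simpa [A] using congrArg Prod.fst h)
    have h2 : A⁻¹ * (A⁻¹ * q) ≠ 1 := fun h => hq (by simpa [A] using congrArg Prod.fst h)
    rw [hx, RegularWreathProduct.left_commutator_conj_inl]
    simp [f, if_neg h0, if_neg h1, if_neg h2]
  refine ⟨x, ?_, fun g hg => ?_⟩
  · simp [x, hQ]
  · rw [← hΦ]
    apply hleft
    have := congrFun (congrArg RegularWreathProduct.left (congrArg Φ hg)) (Φ g).right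
    simp only [_root_.map_mul, RegularWreathProduct.mul_left, Pi.mul_apply, hright,
      inv_mul_cancel, inv_one, one_mul] at this
    rw [mul_comm, mul_right_cancel_iff] at this
    rwa [← this]

lemma IsNonAbelianFree.isFreeGroup {F : Type} [Group F] (hF : IsNonAbelianFree F) :
    IsFreeGroup F := by
  obtain ⟨⟨S, ⟨e⟩⟩, -⟩ := hF
  exact IsFreeGroup.ofMulEquiv e.symm

/-- Every normal subgroup of finite index in a non-abelian free group contains the centralizer
of one of its elements. -/
lemma IsNonAbelianFree.exists_centralizer_le {F : Type} [Group F] (hF : IsNonAbelianFree F)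
    (N : Subgroup F) [N.Normal] [N.FiniteIndex] :
    ∃ x ∈ N, ∀ g, g * x = x * g → g ∈ N := by
  obtain ⟨⟨S, ⟨e⟩⟩, c, d, hcd⟩ := hF
  have hS : Nontrivial S := by
    by_contra hS
    rw [not_nontrivial_iff_subsingleton] at hS
    apply hcd
    apply e.injective
    rw [map_mul, map_mul]
    rcases isEmpty_or_nonempty S with hS | ⟨⟨s⟩⟩
    · exact Subsingleton.elim _ _
    · classical
      obtain ⟨k, hk⟩ := FreeGroup.exists_mk_eq_zpow s (e c).toWord fun y _ => Subsingleton.elim _ _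
      obtain ⟨l, hl⟩ := FreeGroup.exists_mk_eq_zpow s (e d).toWord fun y _ => Subsingleton.elim _ _
      rw [FreeGroup.mk_toWord] at hk hl
      rw [hk, hl, ← zpow_add, ← zpow_add, add_comm]
  obtain ⟨a, b, hab⟩ := exists_pair_ne S
  obtain ⟨x, hx, hcx⟩ := FreeGroup.exists_centralizer_le_ker
    ((QuotientGroup.mk' N).comp e.symm.toMonoidHom) (Nat.card_pos (α := F ⧸ N)).ne'
    (fun q => pow_card_eq_one') hab
  refine ⟨e.symm x, by simpa using hx, fun g hg => ?_⟩
  have := hcx (e g) (by simpa using congrArg e hg)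
  simpa using this

namespace IsSubdirect

variable {F₁ F₂ : Type} [Group F₁] [Group F₂] {G : Subgroup (F₁ × F₂)}

lemma exists_mk_left_mem (hG : IsSubdirect G) (a : F₁) : ∃ b, (a, b) ∈ G := by
  obtain ⟨⟨a', b⟩, h, rfl⟩ : a ∈ G.map (MonoidHom.fst F₁ F₂) := hG.1 ▸ Subgroup.mem_top a
  exact ⟨b, h⟩

lemma exists_mk_right_mem (hG : IsSubdirect G) (b : F₂) : ∃ a, (a, b) ∈ G := by
  obtain ⟨⟨a, b'⟩, h, rfl⟩ : b ∈ G.map (MonoidHom.snd F₁ F₂) := hG.2 ▸ Subgroup.mem_top b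
  exact ⟨a, h⟩

lemma normal_comap_inr (hG : IsSubdirect G) : (G.comap (MonoidHom.inr F₁ F₂)).Normal where
  conj_mem n hn b := by
    obtain ⟨a, ha⟩ := hG.exists_mk_right_mem b
    simpa using G.mul_mem (G.mul_mem ha hn) (G.inv_mem ha)

lemma index_comap_inl (hG : IsSubdirect G) :
    (G.comap (MonoidHom.inl F₁ F₂)).index = G.index := by
  have hrel (a b : F₁) : QuotientGroup.leftRel (G.comap (MonoidHom.inl F₁ F₂)) a b ↔
      QuotientGroup.leftRel G (a, 1) (b, 1) := by
    simp [QuotientGroup.leftRel_apply]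
  refine Nat.card_congr (Equiv.ofBijective
    (Quotient.map' (fun a => (a, 1)) fun a b => (hrel a b).mp) ⟨?_, ?_⟩)
  · rintro ⟨a⟩ ⟨b⟩ hab
    exact Quotient.sound' ((hrel a b).mpr (Quotient.exact' hab))
  · rintro ⟨a, b⟩
    obtain ⟨a', ha'⟩ := hG.exists_mk_right_mem b
    refine ⟨Quotient.mk'' (a * a'⁻¹), Quotient.sound' ?_⟩
    rw [QuotientGroup.leftRel_apply]
    simpa using ha'

lemma isCoP_comap_inr {p : ℕ} (hG : IsSubdirect G) [G.FiniteIndex]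
    (h : IsCoP p (G.comap (MonoidHom.inl F₁ F₂))) : IsCoP p (G.comap (MonoidHom.inr F₁ F₂)) where
  normal := hG.normal_comap_inr
  finiteIndex := G.finiteIndex_comap _
  exists_pow_mem b := by
    obtain ⟨a, ha⟩ := hG.exists_mk_right_mem b
    obtain ⟨k, hk⟩ := h.exists_pow_mem a
    exact ⟨k, by simpa using G.mul_mem (G.inv_mem hk) (G.pow_mem ha (p ^ k))⟩

theorem conjSepC_of_isCoP {p : ℕ} [Fact p.Prime] (hG : IsSubdirect G) [G.FiniteIndex]
    [IsFreeGroup F₁] [IsFreeGroup F₂] (h₁ : IsCoP p (G.comap (MonoidHom.inl F₁ F₂))) :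
    ConjSepC (CP p) G := by
  rintro ⟨⟨x₁, x₂⟩, hx⟩ ⟨⟨y₁, y₂⟩, hy⟩ hxy
  set N₁ := G.comap (MonoidHom.inl F₁ F₂) with hN₁
  set N₂ := G.comap (MonoidHom.inr F₁ F₂) with hN₂
  have h₂ : IsCoP p N₂ := hG.isCoP_comap_inr h₁
  have := h₁.finite_quotient
  choose s hs using hG.exists_mk_left_mem
  -- representatives of the cosets of `N₁ × N₂` in `G`
  let r₁ : F₁ ⧸ N₁ → F₁ := Quotient.out
  let r₂ : F₁ ⧸ N₁ → F₂ := fun q => s (r₁ q)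
  have hr (q) : (r₁ q, r₂ q) ∈ G := hs _
  have key (q : F₁ ⧸ N₁) : ∃ L : Subgroup G, IsCoP p L ∧
      ∀ (n₁ : F₁) (n₂ : F₂) (h : (r₁ q * n₁, r₂ q * n₂) ∈ G), n₁ ∈ N₁ → n₂ ∈ N₂ →
        (⟨_, h⟩ * ⟨(x₁, x₂), hx⟩ * ⟨_, h⟩⁻¹ * ⟨(y₁, y₂), hy⟩⁻¹ : G) ∉ L := by
    by_cases hq : ∀ n ∈ N₁, n * x₁ * n⁻¹ ≠ (r₁ q)⁻¹ * y₁ * r₁ q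
    · obtain ⟨L, hL, hsep⟩ := exists_isCoP_separating h₁ _ _ hq
      refine ⟨_, hL.comap ((MonoidHom.fst F₁ F₂).comp G.subtype), fun n₁ n₂ h hn₁ _ hmem => ?_⟩
      apply hsep n₁ hn₁
      have := hL.normal.conj_mem _ hmem (r₁ q)⁻¹
      simpa [mul_assoc] using this
    · push Not at hq
      obtain ⟨m₁, hm₁, hm₁'⟩ := hq
      have hq₂ : ∀ n ∈ N₂, n * x₂ * n⁻¹ ≠ (r₂ q)⁻¹ * y₂ * r₂ q := by
        intro m₂ hm₂ hm₂'
        have hm : (m₁, m₂) ∈ G := by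
          have := G.mul_mem (Subgroup.mem_comap.mp hm₁) (Subgroup.mem_comap.mp hm₂)
          simpa using this
        refine hxy (isConj_iff.mpr ⟨⟨_, G.mul_mem (hr q) hm⟩, Subtype.ext (Prod.ext ?_ ?_)⟩)
        · have : r₁ q * (m₁ * x₁ * m₁⁻¹) * (r₁ q)⁻¹ = y₁ := by rw [hm₁']; group
          simpa [mul_assoc] using this
        · have : r₂ q * (m₂ * x₂ * m₂⁻¹) * (r₂ q)⁻¹ = y₂ := by rw [hm₂']; group
          simpa [mul_assoc] using this
      obtain ⟨L, hL, hsep⟩ := exists_isCoP_separating h₂ _ _ hq₂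
      refine ⟨_, hL.comap ((MonoidHom.snd F₁ F₂).comp G.subtype), fun n₁ n₂ h _ hn₂ hmem => ?_⟩
      apply hsep n₂ hn₂
      have := hL.normal.conj_mem _ hmem (r₂ q)⁻¹
      simpa [mul_assoc] using this
  choose L hL hsep using key
  have hcop := IsCoP.iInf hL
  have := hcop.normal
  refine ⟨GrpB.of (G ⧸ ⨅ q, L q), ⟨hcop.finite_quotient, hcop.isPGroup_quotient⟩,
    QuotientGroup.mk' _, fun hconj => ?_⟩
  obtain ⟨c, hc⟩ := isConj_iff.mp hconj
  obtain ⟨⟨⟨g₁, g₂⟩, hg⟩, rfl⟩ := QuotientGroup.mk'_surjective _ c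
  let q : F₁ ⧸ N₁ := QuotientGroup.mk g₁
  have hn₁ : (r₁ q)⁻¹ * g₁ ∈ N₁ := QuotientGroup.eq.mp (Quotient.out_eq' q)
  have hn₂ : (r₂ q)⁻¹ * g₂ ∈ N₂ := by
    have := G.mul_mem (G.inv_mem (Subgroup.mem_comap.mp hn₁)) (G.mul_mem (G.inv_mem (hr q)) hg)
    rw [hN₂, Subgroup.mem_comap]
    simpa using this
  have hmem : (⟨(g₁, g₂), hg⟩ * ⟨(x₁, x₂), hx⟩ * ⟨(g₁, g₂), hg⟩⁻¹ * ⟨(y₁, y₂), hy⟩⁻¹ : G) ∈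
      ⨅ q, L q := by
    rw [← QuotientGroup.eq_one_iff]
    exact mul_inv_eq_one.mpr hc
  refine hsep q _ _ (by simpa using hg) hn₁ hn₂ ?_
  simpa using Subgroup.mem_iInf.mp hmem q

theorem isPGroup_quotient_of_conjSepC {p : ℕ} [Fact p.Prime] (hG : IsSubdirect G) [G.FiniteIndex]
    (hF₁ : IsNonAbelianFree F₁) (hF₂ : IsNonAbelianFree F₂)
    [(G.comap (MonoidHom.inl F₁ F₂)).Normal] (h : ConjSepC (CP p) G) :
    IsPGroup p (F₁ ⧸ G.comap (MonoidHom.inl F₁ F₂)) := by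
  set N₁ := G.comap (MonoidHom.inl F₁ F₂) with hN₁
  set N₂ := G.comap (MonoidHom.inr F₁ F₂) with hN₂
  have : N₂.Normal := hG.normal_comap_inr
  have : N₁.FiniteIndex := G.finiteIndex_comap _
  have : N₂.FiniteIndex := G.finiteIndex_comap _
  obtain ⟨x₁, hx₁, hC₁⟩ := hF₁.exists_centralizer_le N₁
  obtain ⟨x₂, hx₂, hC₂⟩ := hF₂.exists_centralizer_le N₂
  -- elements of order prime to `p` in the quotient are trivial
  have key (f : F₁) (hf : (orderOf (f : F₁ ⧸ N₁)).Coprime p) : f ∈ N₁ := by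
    by_contra hfN
    obtain ⟨f₂, hf₂⟩ := hG.exists_mk_left_mem f
    have hy₁ : f * x₁ * f⁻¹ ∈ N₁ := Subgroup.Normal.conj_mem ‹_› _ hx₁ _
    let X₁ : G := ⟨(x₁, 1), hx₁⟩
    let X₂ : G := ⟨(1, x₂), hx₂⟩
    let Y₁ : G := ⟨(f * x₁ * f⁻¹, 1), hy₁⟩
    have hnot : ¬ IsConj (X₁ * X₂) (Y₁ * X₂) := by
      intro hconj
      obtain ⟨⟨⟨c, d⟩, hcd⟩, hc⟩ := isConj_iff.mp hconj
      have hc := congrArg Subtype.val hc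
      simp only [X₁, X₂, Y₁, Subgroup.coe_mul, Subgroup.coe_inv, Prod.mk_mul_mk, Prod.inv_mk,
        Prod.mk.injEq, mul_one, one_mul] at hc
      have hd : d ∈ N₂ := hC₂ d (mul_inv_eq_iff_eq_mul.mp hc.2)
      have hcN : c ∈ N₁ := by
        have := G.mul_mem hcd (G.inv_mem (Subgroup.mem_comap.mp hd))
        rw [hN₁, Subgroup.mem_comap]
        simpa using this
      have hfc : f⁻¹ * c ∈ N₁ := by
        apply hC₁
        rw [mul_assoc, mul_inv_eq_iff_eq_mul.mp hc.1]
        group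
      exact hfN (by simpa using N₁.mul_mem hcN (N₁.inv_mem hfc))
    obtain ⟨M, ⟨_, hM⟩, φ, hφ⟩ := h _ _ hnot
    let g : G := ⟨(f, f₂), hf₂⟩
    obtain ⟨k, hk⟩ := hM (φ g)
    obtain ⟨j, hj⟩ := exists_pow_eq_self_of_coprime (x := (f : F₁ ⧸ N₁))
      (n := p ^ k) (Nat.Coprime.pow_left k hf.symm)
    have hker : φ ((g ^ p ^ k) ^ j) = 1 := by rw [map_pow, map_pow, hk, one_pow]
    have hn : ((f ^ p ^ k) ^ j)⁻¹ * f ∈ N₁ := by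
      rw [← QuotientGroup.eq]
      exact hj
    let n : G := ⟨(((f ^ p ^ k) ^ j)⁻¹ * f, 1), hn⟩
    have hY : Y₁ = (g ^ p ^ k) ^ j * n * X₁ * ((g ^ p ^ k) ^ j * n)⁻¹ := by
      apply Subtype.ext
      simp [Y₁, X₁, g, n, mul_assoc]
    have hcomm : n * X₂ = X₂ * n := by
      apply Subtype.ext
      simp [X₂, n]
    apply hφ
    refine isConj_iff.mpr ⟨φ n, ?_⟩
    have hcomm' := congrArg φ hcomm
    rw [map_mul, map_mul] at hcomm'
    rw [hY, map_mul, map_mul, map_mul, map_mul, map_inv, map_mul, hker, one_mul]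
    rw [mul_inv_eq_iff_eq_mul, mul_assoc _ _ (φ n), ← hcomm']
    group
  intro q
  induction q using QuotientGroup.induction_on with
  | H f =>
    have hpos : 0 < orderOf (f : F₁ ⧸ N₁) := orderOf_pos _
    obtain ⟨k, m, hm, hkm⟩ := Nat.exists_eq_pow_mul_and_not_dvd hpos.ne' p
      (Fact.out : p.Prime).ne_one
    refine ⟨k, ?_⟩
    rw [← QuotientGroup.mk_pow, QuotientGroup.eq_one_iff]
    apply key
    rw [QuotientGroup.mk_pow, orderOf_pow_of_dvd (pow_ne_zero _ (Fact.out : p.Prime).ne_zero)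
      (hkm ▸ dvd_mul_right _ _), hkm,
      Nat.mul_div_cancel_left _ (pow_pos (Fact.out : p.Prime).pos k)]
    exact ((Fact.out : p.Prime).coprime_iff_not_dvd.mpr hm).symm

end IsSubdirect

/-- Corollary 4.13: a finite-index subdirect product of two
non-abelian free groups is `p`-conjugacy separable iff `F₁/N₁` is a finite
`p`-group iff the index is a power of `p`. -/
theorem stmt2 (p : ℕ) (hp : p.Prime)
    (F₁ F₂ : Type) [Group F₁] [Group F₂]
    (hF₁ : IsNonAbelianFree F₁) (hF₂ : IsNonAbelianFree F₂)
    (G : Subgroup (F₁ × F₂)) (hG : IsSubdirect G) (hfi : G.index ≠ 0)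
    (N₁ : Subgroup F₁) (hN₁ : N₁ = Subgroup.comap (MonoidHom.inl F₁ F₂) G) [N₁.Normal] :
    (ConjSepC (CP p) ↥G ↔ (Finite (F₁ ⧸ N₁) ∧ IsPGroup p (F₁ ⧸ N₁))) ∧
    ((Finite (F₁ ⧸ N₁) ∧ IsPGroup p (F₁ ⧸ N₁)) ↔ ∃ n : ℕ, G.index = p ^ n) := by
  subst hN₁
  have := Fact.mk hp
  have : G.FiniteIndex := ⟨hfi⟩
  have := hF₁.isFreeGroup
  have := hF₂.isFreeGroup
  have hfin : Finite (F₁ ⧸ G.comap (MonoidHom.inl F₁ F₂)) :=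
    have := G.finiteIndex_comap (MonoidHom.inl F₁ F₂)
    inferInstance
  refine ⟨⟨fun h => ⟨hfin, hG.isPGroup_quotient_of_conjSepC hF₁ hF₂ h⟩, fun ⟨_, h⟩ => ?_⟩, ?_⟩
  · refine hG.conjSepC_of_isCoP ⟨inferInstance, G.finiteIndex_comap _, fun g => ?_⟩
    obtain ⟨k, hk⟩ := h g
    exact ⟨k, by rwa [← QuotientGroup.mk_pow, QuotientGroup.eq_one_iff] at hk⟩
  · rw [and_iff_right hfin, IsPGroup.iff_card, ← hG.index_comap_inl, Subgroup.index]
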